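/- Let Φ be a norm on ℝ^{n+1} cylindrical over a norm φ on ℝ^n, Ω̂ ⊆ ℝ^n an open set, u ∈ M_{Φ^o}(Ω̂), and λ ∈ ℝ. Then the superlevel sets {x ∈ Ω̂ : u(x) > λ} and {x ∈ Ω̂ : u(x) ≥ λ} are minimizers of P_φ in Ω̂. -/

import Mathlib

open MeasureTheory Set Filter

noncomputable section

/-- `ℝ^n` with the Euclidean norm. -/
abbrev Rn (n : ℕ) := EuclideanSpace ℝ (Fin n)

/-- `ℝ^{n+1} = ℝ^n × ℝ`. -/
abbrev Rn1 (n : ℕ) := Rn n × ℝ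

/-- Euclidean dot product on `ℝ^n`. -/
def dotn {n : ℕ} (x y : Rn n) : ℝ := ∑ i, x i * y i

/-- Euclidean dot product on `ℝ^{n+1} = ℝ^n × ℝ`. -/
def dotp {n : ℕ} (x y : Rn1 n) : ℝ := dotn x.1 y.1 + x.2 * y.2

/-- Euclidean norm on `ℝ^{n+1} = ℝ^n × ℝ`. -/
def enorm1 {n : ℕ} (x : Rn1 n) : ℝ := Real.sqrt (dotp x x)

/-- `Ψ` is a norm on `ℝ^n`: convex, absolutely one-homogeneous and bounded
below by a positive multiple of the Euclidean norm. -/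
def IsNormN {n : ℕ} (Ψ : Rn n → ℝ) : Prop :=
  ConvexOn ℝ univ Ψ ∧ (∀ (c : ℝ) (ξ : Rn n), Ψ (c • ξ) = |c| * Ψ ξ) ∧
    ∃ c > (0:ℝ), ∀ ξ, c * ‖ξ‖ ≤ Ψ ξ

/-- `Φ` is a norm on `ℝ^{n+1}`. -/
def IsNorm1 {n : ℕ} (Φ : Rn1 n → ℝ) : Prop :=
  ConvexOn ℝ univ Φ ∧ (∀ (c : ℝ) (ξ : Rn1 n), Φ (c • ξ) = |c| * Φ ξ) ∧
    ∃ c > (0:ℝ), ∀ ξ, c * enorm1 ξ ≤ Φ ξ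

/-- Dual norm on `ℝ^n`: `Ψ^o(ξ*) = sup {ξ*·ξ : Ψ(ξ) ≤ 1}`. -/
def dualN {n : ℕ} (Ψ : Rn n → ℝ) (xs : Rn n) : ℝ :=
  sSup ((fun ξ => dotn xs ξ) '' {ξ | Ψ ξ ≤ 1})

/-- Dual norm on `ℝ^{n+1}`. -/
def dual1 {n : ℕ} (Φ : Rn1 n → ℝ) (xs : Rn1 n) : ℝ :=
  sSup ((fun ξ => dotp xs ξ) '' {ξ | Φ ξ ≤ 1})

/-- `Φ` is cylindrical over `φ`: `Φ(ξ̂,ξ_{n+1}) = max (φ(ξ̂), |ξ_{n+1}|)`. -/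
def Cylindrical {n : ℕ} (Φ : Rn1 n → ℝ) (φ : Rn n → ℝ) : Prop :=
  ∀ ξ : Rn1 n, Φ ξ = max (φ ξ.1) |ξ.2|

/-- `A` is an open set compactly contained in `O`. -/
def CpCtd {E : Type*} [TopologicalSpace E] (A O : Set E) : Prop :=
  IsOpen A ∧ IsCompact (closure A) ∧ closure A ⊆ O

/-- Divergence of a vector field on `ℝ^n`. -/
def divN {n : ℕ} (η : Rn n → Rn n) (x : Rn n) : ℝ :=
  ∑ i, fderiv ℝ η x (EuclideanSpace.single i (1:ℝ)) i

/-- Divergence of a vector field on `ℝ^{n+1} = ℝ^n × ℝ`. -/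
def div1 {n : ℕ} (η : Rn1 n → Rn1 n) (z : Rn1 n) : ℝ :=
  (∑ i, (fderiv ℝ η z (EuclideanSpace.single i (1:ℝ), (0:ℝ))).1 i) +
    (fderiv ℝ η z ((0 : Rn n), (1:ℝ))).2

/-- Admissible test vector fields on `ℝ^n`: `C^1`, compactly supported in `A`,
with values in the unit ball of `Ψ`. -/
def TestN {n : ℕ} (A : Set (Rn n)) (Ψ : Rn n → ℝ) (η : Rn n → Rn n) : Prop :=
  ContDiff ℝ 1 η ∧ HasCompactSupport η ∧ tsupport η ⊆ A ∧ ∀ x, Ψ (η x) ≤ 1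

/-- Admissible test vector fields on `ℝ^{n+1}`. -/
def Test1 {n : ℕ} (A : Set (Rn1 n)) (Φ : Rn1 n → ℝ) (η : Rn1 n → Rn1 n) : Prop :=
  ContDiff ℝ 1 η ∧ HasCompactSupport η ∧ tsupport η ⊆ A ∧ ∀ z, Φ (η z) ≤ 1

/-- The set of numbers whose supremum is the anisotropic perimeter `P_Ψ(E,A)` in `ℝ^n`. -/
def perSetN {n : ℕ} (Ψ : Rn n → ℝ) (E A : Set (Rn n)) : Set ℝ :=
  {r | ∃ η, TestN A Ψ η ∧ r = -∫ x in E, divN η x}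

/-- Anisotropic perimeter `P_Ψ(E,A)` in `ℝ^n`. -/
def PerN {n : ℕ} (Ψ : Rn n → ℝ) (E A : Set (Rn n)) : ℝ := sSup (perSetN Ψ E A)

/-- `E` has locally finite perimeter in `O ⊆ ℝ^n`. -/
def BVlocSetN {n : ℕ} (O E : Set (Rn n)) : Prop :=
  ∀ A, CpCtd A O → BddAbove (perSetN (fun x => ‖x‖) E A)

/-- `E` is a minimizer of `P_Ψ` (by compact perturbations) in `O ⊆ ℝ^n`. -/
def MinPerN {n : ℕ} (Ψ : Rn n → ℝ) (O E : Set (Rn n)) : Prop :=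
  BVlocSetN O E ∧ ∀ A, CpCtd A O → ∀ F, BVlocSetN O F →
    IsCompact (closure (symmDiff E F)) → closure (symmDiff E F) ⊆ A →
      PerN Ψ E A ≤ PerN Ψ F A

/-- The set of numbers whose supremum is the anisotropic perimeter `P_Φ(E,A)` in `ℝ^{n+1}`. -/
def perSet1 {n : ℕ} (Φ : Rn1 n → ℝ) (E A : Set (Rn1 n)) : Set ℝ :=
  {r | ∃ η, Test1 A Φ η ∧ r = -∫ z in E, div1 η z}

/-- Anisotropic perimeter `P_Φ(E,A)` in `ℝ^{n+1}`. -/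
def Per1 {n : ℕ} (Φ : Rn1 n → ℝ) (E A : Set (Rn1 n)) : ℝ := sSup (perSet1 Φ E A)

/-- `E` has locally finite perimeter in `O ⊆ ℝ^{n+1}`. -/
def BVlocSet1 {n : ℕ} (O E : Set (Rn1 n)) : Prop :=
  ∀ A, CpCtd A O → BddAbove (perSet1 enorm1 E A)

/-- `E` is a minimizer of `P_Φ` (by compact perturbations) in `O ⊆ ℝ^{n+1}`. -/
def MinPer1 {n : ℕ} (Φ : Rn1 n → ℝ) (O E : Set (Rn1 n)) : Prop :=
  BVlocSet1 O E ∧ ∀ A, CpCtd A O → ∀ F, BVlocSet1 O F →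
    IsCompact (closure (symmDiff E F)) → closure (symmDiff E F) ⊆ A →
      Per1 Φ E A ≤ Per1 Φ F A

/-- The set of numbers whose supremum is the total variation `TV(u,A)`. -/
def varSet {n : ℕ} (A : Set (Rn n)) (u : Rn n → ℝ) : Set ℝ :=
  {r | ∃ η, TestN A (fun x => ‖x‖) η ∧ r = ∫ x in A, u x * divN η x}

/-- Total variation `TV(u,A)`. -/
def TV {n : ℕ} (u : Rn n → ℝ) (A : Set (Rn n)) : ℝ := sSup (varSet A u)

/-- `u ∈ BV_loc(Ω̂)`. -/
def BVlocFun {n : ℕ} (Ω : Set (Rn n)) (u : Rn n → ℝ) : Prop :=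
  (∀ A, CpCtd A Ω → IntegrableOn u A) ∧ ∀ A, CpCtd A Ω → BddAbove (varSet A u)

/-- The set of numbers whose supremum is `G_{Φ^o}(u,A)`. -/
def Gset {n : ℕ} (Φ : Rn1 n → ℝ) (A : Set (Rn n)) (u : Rn n → ℝ) : Set ℝ :=
  {r | ∃ η : Rn n → Rn1 n, ContDiff ℝ 1 η ∧ HasCompactSupport η ∧ tsupport η ⊆ A ∧
    (∀ x, Φ (η x) ≤ 1) ∧ r = ∫ x in A, (u x * divN (fun y => (η y).1) x + (η x).2)}

/-- The functional `G_{Φ^o}(u,A)`. -/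
def Gfun {n : ℕ} (Φ : Rn1 n → ℝ) (u : Rn n → ℝ) (A : Set (Rn n)) : ℝ := sSup (Gset Φ A u)

/-- `w` has compact support contained in `A`. -/
def CptSupp {n : ℕ} (A : Set (Rn n)) (w : Rn n → ℝ) : Prop :=
  IsCompact (tsupport w) ∧ tsupport w ⊆ A

/-- `u` is a minimizer of `G_{Φ^o}` by compact perturbations in `Ω̂`,
i.e. `u ∈ M_{Φ^o}(Ω̂)`. -/
def MinG {n : ℕ} (Φ : Rn1 n → ℝ) (Ω : Set (Rn n)) (u : Rn n → ℝ) : Prop :=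
  BVlocFun Ω u ∧ ∀ A, CpCtd A Ω → ∀ v, BVlocFun Ω v →
    CptSupp A (fun x => u x - v x) → Gfun Φ u A ≤ Gfun Φ v A

/-- `u` is a minimizer of the total variation by compact perturbations in `Ω̂`. -/
def MinTV {n : ℕ} (Ω : Set (Rn n)) (u : Rn n → ℝ) : Prop :=
  BVlocFun Ω u ∧ ∀ A, CpCtd A Ω → ∀ v, BVlocFun Ω v →
    CptSupp A (fun x => u x - v x) → TV u A ≤ TV v A

/-- Subgraph of `u : Ω̂ → ℝ`. -/
def sg {n : ℕ} (Ω : Set (Rn n)) (u : Rn n → ℝ) : Set (Rn1 n) :=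
  {p | p.1 ∈ Ω ∧ p.2 < u p.1}

/-- `S` is locally a Lipschitz graph at `p`. -/
def IsLocLipGraphAt {n : ℕ} (S : Set (Rn1 n)) (p : Rn1 n) : Prop :=
  ∃ U : Set (Rn1 n), IsOpen U ∧ p ∈ U ∧ ∃ e : Rn1 n, enorm1 e = 1 ∧
    ∃ g : Rn1 n → ℝ, (∃ L : NNReal, LipschitzOnWith L g {y | dotp y e = 0}) ∧
      S ∩ U = {z | ∃ y, dotp y e = 0 ∧ z = y + g y • e} ∩ U

/-- `Φ` is a partially monotone norm on `ℝ^{n+1}`. -/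
def PartMono {n : ℕ} (Φ : Rn1 n → ℝ) : Prop :=
  ∀ ξ η : Rn1 n, Φ (ξ.1, 0) ≤ Φ (η.1, 0) → Φ ((0 : Rn n), ξ.2) ≤ Φ ((0 : Rn n), η.2) →
    Φ ξ ≤ Φ η

end


open scoped Topology Convolution

lemma divN_smul' {n : ℕ} {f : Rn n → ℝ} {η : Rn n → Rn n} {x : Rn n}
    (hf : DifferentiableAt ℝ f x) (hη : DifferentiableAt ℝ η x) :
    divN (fun y => f y • η y) x = f x * divN η x + fderiv ℝ f x (η x) := by
  unfold divN
  have h : fderiv ℝ (fun y => f y • η y) x = f x • fderiv ℝ η x + (fderiv ℝ f x).smulRight (η x) :=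
    fderiv_fun_smul hf hη
  rw [h]
  have h2 : η x = ∑ i, η x i • EuclideanSpace.single i (1:ℝ) := by
    ext j
    simp [Finset.sum_apply, Pi.single_apply]
  have h3 : fderiv ℝ f x (η x) = ∑ i, η x i * fderiv ℝ f x (EuclideanSpace.single i (1:ℝ)) := by
    conv_lhs => rw [h2]
    simp [map_sum]
  rw [h3, Finset.mul_sum, ← Finset.sum_add_distrib]
  refine Finset.sum_congr rfl fun i _ => ?_
  simp
  ring

lemma divN_add' {n : ℕ} {η ζ : Rn n → Rn n} {x : Rn n}
    (hη : DifferentiableAt ℝ η x) (hζ : DifferentiableAt ℝ ζ x) :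
    divN (fun y => η y + ζ y) x = divN η x + divN ζ x := by
  unfold divN
  rw [fderiv_fun_add hη hζ, ← Finset.sum_add_distrib]
  simp

lemma divN_csmul {n : ℕ} (c : ℝ) {η : Rn n → Rn n} (x : Rn n) (hη : DifferentiableAt ℝ η x) :
    divN (fun y => c • η y) x = c * divN η x := by
  rw [divN_smul' (differentiableAt_const c) hη]; simp

lemma divN_shift {n : ℕ} {η : Rn n → Rn n} (x h : Rn n) :
    divN (fun y => η (y + h)) x = divN η (x + h) := by
  unfold divN
  rw [fderiv_comp_add_right]

lemma divN_cont {n : ℕ} {η : Rn n → Rn n} (hη : ContDiff ℝ 1 η) : Continuous (divN η) := by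
  unfold divN
  have := hη.continuous_fderiv (by norm_num)
  fun_prop

lemma divN_zero_of_notMem {n : ℕ} {η : Rn n → Rn n} {x : Rn n} (hx : x ∉ tsupport η) :
    divN η x = 0 := by
  unfold divN
  rw [fderiv_of_notMem_tsupport ℝ hx]
  simp

lemma divN_supp {n : ℕ} {η : Rn n → Rn n} (hη : HasCompactSupport η) :
    HasCompactSupport (divN η) :=
  HasCompactSupport.intro hη fun _ hx => divN_zero_of_notMem hx

lemma divN_integrable {n : ℕ} {η : Rn n → Rn n} (hη : ContDiff ℝ 1 η)
    (hs : HasCompactSupport η) : Integrable (divN η) :=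
  (divN_cont hη).integrable_of_hasCompactSupport (divN_supp hs)

lemma integral_divN {n : ℕ} {η : Rn n → Rn n} (hη : ContDiff ℝ 1 η)
    (hs : HasCompactSupport η) : ∫ x, divN η x = 0 := by
  unfold divN
  have hc := hη.continuous_fderiv (by norm_num)
  have hi : ∀ v : Rn n, Integrable (fun x => fderiv ℝ η x v) := fun v =>
    Continuous.integrable_of_hasCompactSupport (by fun_prop)
      (HasCompactSupport.intro hs fun x hx => by rw [fderiv_of_notMem_tsupport ℝ hx]; simp)
  have h0 : ∀ v : Rn n, ∫ x, fderiv ℝ η x v = 0 := by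
    intro v
    have := integral_smul_fderiv_eq_neg_fderiv_smul_of_integrable (μ := (volume : Measure (Rn n)))
      (f := fun _ => (1:ℝ)) (g := η) (v := v) (by simp) (by simpa using hi v)
      (by simpa using hη.continuous.integrable_of_hasCompactSupport hs)
      (fun _ _ => differentiableAt_const _) (fun x _ => (hη.differentiable (by norm_num)) x)
    simpa using this
  have hp : ∀ i : Fin n, ∀ x, fderiv ℝ η x (EuclideanSpace.single i (1:ℝ)) i
      = EuclideanSpace.proj (𝕜 := ℝ) i (fderiv ℝ η x (EuclideanSpace.single i (1:ℝ))) := by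
    intro i x; rfl
  simp_rw [hp]
  rw [integral_finsetSum _ fun i _ => ContinuousLinearMap.integrable_comp _ (hi _)]
  refine Finset.sum_eq_zero fun i _ => ?_
  rw [ContinuousLinearMap.integral_comp_comm _ (hi _), h0, map_zero]

lemma TestN.shift {n : ℕ} {A K : Set (Rn n)} {Ψ : Rn n → ℝ} {η : Rn n → Rn n}
    (h1 : ContDiff ℝ 1 η) (h2 : HasCompactSupport η) (h3 : tsupport η ⊆ K)
    (h4 : ∀ x, Ψ (η x) ≤ 1)
    {δ : ℝ} (hδ : Metric.cthickening δ K ⊆ A) {h : Rn n} (hh : ‖h‖ ≤ δ) :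
    TestN A Ψ (fun x => η (x + h)) := by
  refine ⟨h1.comp (contDiff_id.add contDiff_const),
    h2.comp_homeomorph (Homeomorph.addRight h), ?_, fun x => h4 _⟩
  have : tsupport (fun x => η (x + h)) ⊆ (fun x => x + h) ⁻¹' tsupport η :=
    tsupport_comp_subset_preimage η (by fun_prop)
  intro x hx
  apply hδ
  refine Metric.mem_cthickening_of_dist_le x (x + h) δ K (h3 (this hx)) ?_
  simpa [dist_eq_norm] using hh

lemma setInt_eq {n : ℕ} {A : Set (Rn n)} (hA : IsOpen A) {ζ : Rn n → Rn n}
    (hζ : tsupport ζ ⊆ A) {F G : Rn n → ℝ} (hFG : ∀ x ∈ A, F x = G x) :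
    ∫ x in A, F x * divN ζ x = ∫ x, G x * divN ζ x := by
  rw [← setIntegral_eq_integral_of_forall_compl_eq_zero (s := A) (f := fun x => G x * divN ζ x)]
  · exact setIntegral_congr_fun hA.measurableSet fun x hx => by simp [hFG x hx]
  · intro x hx
    rw [divN_zero_of_notMem fun h => hx (hζ h), mul_zero]

lemma bdd_of_cpt {n : ℕ} {f : Rn n → ℝ} (hf : Continuous f) (hs : HasCompactSupport f) :
    ∃ C, ∀ x, ‖f x‖ ≤ C := hs.exists_bound_of_continuous hf

lemma pair_cont {n : ℕ} {U f : Rn n → ℝ} (hU : Integrable U) (hf : Continuous f)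
    (hs : HasCompactSupport f) : Continuous (fun t => ∫ x, U x * f (x - t)) := by
  obtain ⟨C, hC⟩ := bdd_of_cpt hf hs
  refine continuous_of_dominated (bound := fun x => ‖U x‖ * C) ?_ ?_ ?_ ?_
  · intro t
    exact hU.aestronglyMeasurable.mul (by fun_prop : Continuous fun x => f (x - t)).aestronglyMeasurable
  · intro t
    refine Eventually.of_forall fun x => ?_
    rw [norm_mul]
    exact mul_le_mul_of_nonneg_left (hC _) (norm_nonneg _)
  · exact hU.norm.mul_const C
  · refine Eventually.of_forall fun x => ?_
    fun_prop

lemma conv_pair {n : ℕ} (ρ : ContDiffBump (0 : Rn n)) {U f : Rn n → ℝ} (hU : Integrable U)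
    (hf : Continuous f) (hs : HasCompactSupport f) :
    ∫ x, (ρ.normed volume ⋆[ContinuousLinearMap.lsmul ℝ ℝ, volume] U) x * f x =
      (ρ.normed volume ⋆[ContinuousLinearMap.lsmul ℝ ℝ, volume] fun t => ∫ x, U x * f (x - t)) 0 := by
  obtain ⟨C, hC⟩ := bdd_of_cpt hf hs
  simp only [convolution_def, ContinuousLinearMap.lsmul_apply, smul_eq_mul, ← integral_mul_const]
  have hint : Integrable (fun p : Rn n × Rn n => ρ.normed volume p.2 * U (p.1 - p.2) * f p.1)
      (volume.prod volume) := by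
    have h := Integrable.convolution_integrand (ContinuousLinearMap.lsmul ℝ ℝ) (μ := (volume : Measure (Rn n)))
      (ν := (volume : Measure (Rn n))) (ρ.integrable_normed (μ := volume)) hU
    refine h.mul_bdd (c := C) ?_ ?_
    · exact (hf.comp continuous_fst).aestronglyMeasurable
    · exact Eventually.of_forall fun p => hC _
  rw [integral_integral_swap hint]
  refine integral_congr_ae (Eventually.of_forall fun t => ?_)
  simp only [mul_assoc]
  rw [integral_const_mul]
  congr 1
  rw [← integral_add_right_eq_self _ t]
  simp

lemma conv_le {n : ℕ} (ρ : ContDiffBump (0 : Rn n)) {g : Rn n → ℝ} (hg : Continuous g) {M δ : ℝ}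
    (hM : ∀ t, ‖t‖ ≤ δ → g t ≤ M) (hρ : ρ.rOut ≤ δ) :
    (ρ.normed volume ⋆[ContinuousLinearMap.lsmul ℝ ℝ, volume] g) 0 ≤ M := by
  simp only [convolution_def, ContinuousLinearMap.lsmul_apply, smul_eq_mul]
  have h1 : ∫ t, ρ.normed volume t * M = M := by
    rw [integral_mul_const, ρ.integral_normed, one_mul]
  conv_rhs => rw [← h1]
  refine integral_mono ?_ ?_ ?_
  · refine Continuous.integrable_of_hasCompactSupport ?_ ?_
    · have := ρ.continuous_normed (μ := (volume : Measure (Rn n)))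
      fun_prop
    · exact (ρ.hasCompactSupport_normed (μ := volume)).mul_right
  · exact (ρ.integrable_normed (μ := volume)).mul_const _
  · intro t
    by_cases ht : ‖t‖ ≤ δ
    · exact mul_le_mul_of_nonneg_left (hM _ (by simpa using ht)) (ρ.nonneg_normed t)
    · have : ρ.normed volume t = 0 := by
        by_contra h
        have : t ∈ Function.support (ρ.normed volume) := h
        rw [ρ.support_normed_eq] at this
        simp at this
        exact ht (by linarith)
      simp [this]

lemma key {n : ℕ} {A : Set (Rn n)} (hA : IsOpen A) {φ : Rn n → ℝ} (hφ : ConvexOn ℝ univ φ)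
    {u : Rn n → ℝ} (hu : IntegrableOn u A) {M : ℝ}
    (hM : ∀ θ, TestN A φ θ → ∫ x in A, u x * divN θ x ≤ M) {T : ℝ → ℝ} (hT : ContDiff ℝ 2 T)
    (hT' : ∀ s, 0 ≤ deriv T s ∧ deriv T s ≤ 1) {c : ℝ} (hTb : ∀ s, ‖T s‖ ≤ c)
    {ζ₁ ζ₂ : Rn n → Rn n} (h1 : TestN A φ ζ₁) (h2 : TestN A φ ζ₂) :
    (∫ x in A, (u x - T (u x)) * divN ζ₁ x) + ∫ x in A, T (u x) * divN ζ₂ x ≤ M := by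
  set U : Rn n → ℝ := A.indicator u with hUdef
  have hU : Integrable U := (integrable_indicator_iff hA.measurableSet).2 hu
  have hUA : ∀ x ∈ A, u x = U x := fun x hx => (indicator_of_mem hx u).symm
  have hU1 : ∀ x ∈ A, u x - T (u x) = U x - T (U x) := fun x hx => by rw [hUA x hx]
  have hU2 : ∀ x ∈ A, T (u x) = T (U x) := fun x hx => by rw [hUA x hx]
  rw [setInt_eq hA h1.2.2.1 hU1, setInt_eq hA h2.2.2.1 hU2]
  have hM' : ∀ θ, TestN A φ θ → ∫ x, U x * divN θ x ≤ M := fun θ hθ => by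
    rw [← setInt_eq hA hθ.2.2.1 hUA]; exact hM θ hθ
  obtain ⟨c1, s1, t1, b1⟩ := h1
  obtain ⟨c2, s2, t2, b2⟩ := h2
  set K := tsupport ζ₁ ∪ tsupport ζ₂ with hK
  have hKc : IsCompact K := IsCompact.union s1 s2
  obtain ⟨δ, hδ, hδA⟩ := hKc.exists_cthickening_subset_open hA (union_subset t1 t2)
  let ρ : ℕ → ContDiffBump (0 : Rn n) := fun k =>
    ⟨1 / (k + 1 : ℝ), 2 * (1 / (k + 1 : ℝ)), by positivity, by
      have : 0 < 1 / (k + 1 : ℝ) := by positivity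
      linarith⟩
  have hρ : Tendsto (fun k => (ρ k).rOut) atTop (𝓝 0) := by
    have := (tendsto_one_div_add_atTop_nhds_zero_nat (𝕜 := ℝ)).const_mul 2
    rw [mul_zero] at this
    exact this
  set w : ℕ → Rn n → ℝ := fun k =>
    ((ρ k).normed volume ⋆[ContinuousLinearMap.lsmul ℝ ℝ, volume] U) with hw
  have hwC : ∀ k, ContDiff ℝ 1 (w k) := fun k => by
    refine HasCompactSupport.contDiff_convolution_left (n := 1) (ContinuousLinearMap.lsmul ℝ ℝ)
      ((ρ k).hasCompactSupport_normed) ?_ hU.locallyIntegrable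
    exact (ρ k).contDiff_normed
  have hTd : ContDiff ℝ 1 (deriv T) := by
    have : ContDiff ℝ (1 + 1) T := by simpa [one_add_one_eq_two] using hT
    exact (contDiff_succ_iff_deriv.1 this).2.2
  have hT1 : ContDiff ℝ 1 T := hT.of_le (by norm_num)
  -- the inequality for each k
  have hstep : ∀ᶠ k in atTop, (∫ x, w k x * divN ζ₁ x) + ∫ x, T (w k x) * (divN ζ₂ x - divN ζ₁ x) ≤ M := by
    filter_upwards [hρ.eventually (eventually_le_nhds hδ)] with k hk
    set θ : Rn n → Rn n := fun x => deriv T (w k x) • ζ₂ x + (1 - deriv T (w k x)) • ζ₁ x with hθ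
    have hdw := (hTd.comp (hwC k))
    have hθ1 : ContDiff ℝ 1 θ := by
      refine ContDiff.add (ContDiff.smul hdw c2) (ContDiff.smul (contDiff_const.sub hdw) c1)
    have hθz : ∀ x, x ∉ K → θ x = 0 := fun x hx => by
      have e1 : ζ₁ x = 0 := image_eq_zero_of_notMem_tsupport fun h => hx (Or.inl h)
      have e2 : ζ₂ x = 0 := image_eq_zero_of_notMem_tsupport fun h => hx (Or.inr h)
      simp [hθ, e1, e2]
    have hθ2 : HasCompactSupport θ := HasCompactSupport.intro hKc hθz
    have hθ3 : tsupport θ ⊆ K := closure_minimal (fun x hx => by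
      by_contra h; exact hx (hθz x h)) hKc.isClosed
    have hθ4 : ∀ x, φ (θ x) ≤ 1 := fun x => by
      have := hφ.2 (mem_univ (ζ₂ x)) (mem_univ (ζ₁ x)) (hT' (w k x)).1
        (sub_nonneg.2 (hT' (w k x)).2) (by ring)
      simp only [smul_eq_mul] at this
      have a := mul_le_mul_of_nonneg_left (b2 x) (hT' (w k x)).1
      have b := mul_le_mul_of_nonneg_left (b1 x) (sub_nonneg.2 (hT' (w k x)).2)
      linarith
    have hle : ∫ x, w k x * divN θ x ≤ M := by
      rw [hw]
      simp only
      rw [conv_pair (ρ k) hU (divN_cont hθ1) (divN_supp hθ2)]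
      refine conv_le (ρ k) (pair_cont hU (divN_cont hθ1) (divN_supp hθ2)) (δ := δ) ?_ hk
      intro t ht
      have := hM' _ (TestN.shift hθ1 hθ2 hθ3 hθ4 hδA (h := -t) (by simpa using ht))
      simpa [divN_shift, sub_eq_add_neg] using this
    have hwd : ∀ x, DifferentiableAt ℝ (w k) x := fun x => (hwC k).differentiable (by norm_num) x
    have hTw : ContDiff ℝ 1 (fun x => T (w k x)) := hT1.comp (hwC k)
    have hTwd : ∀ x, DifferentiableAt ℝ (fun x => T (w k x)) x :=
      fun x => hTw.differentiable (by norm_num) x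
    have d1 : ∀ x, DifferentiableAt ℝ ζ₁ x := fun x => c1.differentiable (by norm_num) x
    have d2 : ∀ x, DifferentiableAt ℝ ζ₂ x := fun x => c2.differentiable (by norm_num) x
    have dθ : ∀ x, DifferentiableAt ℝ θ x := fun x => hθ1.differentiable (by norm_num) x
    have hz1 := integral_divN ((hwC k).smul hθ1) (hθ2.smul_left (f := w k))
    have hz2 := integral_divN (((hwC k).sub hTw).smul c1)
      (s1.smul_left (f := fun x => w k x - T (w k x)))
    have hz3 := integral_divN (hTw.smul c2) (s2.smul_left (f := fun x => T (w k x)))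
    have I1 := divN_integrable ((hwC k).smul hθ1) (hθ2.smul_left (f := w k))
    have I2 := divN_integrable (((hwC k).sub hTw).smul c1)
      (s1.smul_left (f := fun x => w k x - T (w k x)))
    have I3 := divN_integrable (hTw.smul c2) (s2.smul_left (f := fun x => T (w k x)))
    have cw := (hwC k).continuous
    have cTw := hTw.continuous
    have J0 : Integrable (fun x => w k x * divN θ x) :=
      (cw.mul (divN_cont hθ1)).integrable_of_hasCompactSupport (divN_supp hθ2).mul_left
    have J1 : Integrable (fun x => w k x * divN ζ₁ x) :=
      (cw.mul (divN_cont c1)).integrable_of_hasCompactSupport (divN_supp s1).mul_left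
    have J2 : Integrable (fun x => T (w k x) * (divN ζ₂ x - divN ζ₁ x)) :=
      (cTw.mul ((divN_cont c2).sub (divN_cont c1))).integrable_of_hasCompactSupport
        ((divN_supp s2).sub (divN_supp s1)).mul_left
    refine le_trans (le_of_eq ?_) hle
    rw [← integral_add J1 J2]
    have hfin : ∫ x, (w k x * divN θ x - (w k x * divN ζ₁ x + T (w k x) * (divN ζ₂ x - divN ζ₁ x))) = 0 := by
      have : ∀ x, (w k x * divN θ x - (w k x * divN ζ₁ x + T (w k x) * (divN ζ₂ x - divN ζ₁ x)))
          = divN (fun x => w k x • θ x) x - divN (fun x => (w k x - T (w k x)) • ζ₁ x) x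
            - divN (fun x => T (w k x) • ζ₂ x) x := by
        intro x
        rw [divN_smul' (hwd x) (dθ x), divN_smul' ((hwd x).fun_sub (hTwd x)) (d1 x),
          divN_smul' (hTwd x) (d2 x)]
        have e1 : fderiv ℝ (fun x => T (w k x)) x = deriv T (w k x) • fderiv ℝ (w k) x := by
          have := ((hT1.differentiable (by norm_num) (w k x)).hasDerivAt.comp_hasFDerivAt x
            (hwd x).hasFDerivAt).fderiv
          exact this
        have e2 : fderiv ℝ (fun x => w k x - T (w k x)) x
            = fderiv ℝ (w k) x - deriv T (w k x) • fderiv ℝ (w k) x := by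
          rw [fderiv_fun_sub (hwd x) (hTwd x), e1]
        rw [e1, e2]
        simp only [hθ, map_add, map_smul, _root_.sub_apply,
          _root_.smul_apply, smul_eq_mul]
        ring
      simp_rw [this]
      erw [integral_sub (I1.sub I2) I3, integral_sub I1 I2, hz1, hz2, hz3]
      simp
    have hs := integral_sub J0 (J1.add J2)
    simp only [Pi.add_apply] at hs
    linarith
  -- limits
  have l1 : Tendsto (fun k => ∫ x, w k x * divN ζ₁ x) atTop (𝓝 (∫ x, U x * divN ζ₁ x)) := by
    have := ContDiffBump.convolution_tendsto_right_of_continuous (μ := (volume : Measure (Rn n)))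
      hρ (pair_cont hU (divN_cont c1) (divN_supp s1)) 0
    simp only [sub_zero] at this
    refine this.congr fun k => ?_
    exact (conv_pair (ρ k) hU (divN_cont c1) (divN_supp s1)).symm
  have hae : ∀ᵐ x, Tendsto (fun k => w k x) atTop (𝓝 (U x)) := by
    refine ContDiffBump.ae_convolution_tendsto_right_of_locallyIntegrable (K := 2) hρ ?_
      hU.locallyIntegrable
    exact Eventually.of_forall fun k => le_rfl
  have hI := (divN_integrable c2 s2).sub (divN_integrable c1 s1)
  have l2 : Tendsto (fun k => ∫ x, T (w k x) * (divN ζ₂ x - divN ζ₁ x)) atTop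
      (𝓝 (∫ x, T (U x) * (divN ζ₂ x - divN ζ₁ x))) := by
    refine tendsto_integral_of_dominated_convergence
      (fun x => c * ‖divN ζ₂ x - divN ζ₁ x‖) ?_ ?_ ?_ ?_
    · intro k
      exact ((hT1.continuous.comp (hwC k).continuous).mul
        ((divN_cont c2).sub (divN_cont c1))).aestronglyMeasurable
    · exact hI.norm.const_mul c
    · intro k
      refine Eventually.of_forall fun x => ?_
      rw [norm_mul]
      exact mul_le_mul_of_nonneg_right (hTb _) (norm_nonneg _)
    · filter_upwards [hae] with x hx
      exact ((hT1.continuous.tendsto _).comp hx).mul_const _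
  refine le_trans (le_of_eq ?_) (le_of_tendsto (l1.add l2) hstep)
  have hTm : AEStronglyMeasurable (fun x => T (U x)) volume :=
    hT1.continuous.comp_aestronglyMeasurable hU.aestronglyMeasurable
  have hm : ∀ {ζ : Rn n → Rn n}, ContDiff ℝ 1 ζ → HasCompactSupport ζ →
      Integrable (fun x => T (U x) * divN ζ x) := fun hc hs =>
    (divN_integrable hc hs).bdd_mul (c := c) hTm (Eventually.of_forall fun x => hTb _)
  have hm1 : Integrable (fun x => U x * divN ζ₁ x) := by
    obtain ⟨C, hC⟩ := bdd_of_cpt (divN_cont c1) (divN_supp s1)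
    exact hU.mul_bdd (c := C) (divN_cont c1).aestronglyMeasurable (Eventually.of_forall hC)
  simp only [sub_mul, mul_sub]
  rw [integral_sub hm1 (hm c1 s1), integral_sub (hm c2 s2) (hm c1 s1)]
  ring

lemma isNormN_norm {n : ℕ} : IsNormN (fun x : Rn n => ‖x‖) :=
  ⟨convexOn_univ_norm, fun c ξ => by simp [norm_smul], 1, one_pos, fun ξ => by simp⟩

lemma IsNormN.zero {n : ℕ} {φ : Rn n → ℝ} (h : IsNormN φ) : φ 0 = 0 := by
  have := h.2.1 0 0
  simpa using this

lemma IsNormN.nonneg {n : ℕ} {φ : Rn n → ℝ} (h : IsNormN φ) (x : Rn n) : 0 ≤ φ x := by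
  obtain ⟨c, hc, h3⟩ := h.2.2
  exact le_trans (by positivity) (h3 x)

lemma IsNormN.upper {n : ℕ} {φ : Rn n → ℝ} (h : IsNormN φ) :
    ∃ C > (0:ℝ), ∀ x, φ x ≤ C * ‖x‖ := by
  have hc : Continuous φ := by
    have := h.1.continuousOn isOpen_univ
    exact continuousOn_univ.1 this
  obtain ⟨C, hC⟩ := (isCompact_closedBall (0 : Rn n) 1).exists_bound_of_continuousOn hc.continuousOn
  refine ⟨|C| + 1, by positivity, fun x => ?_⟩
  by_cases hx : x = 0
  · simp [hx, h.zero]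
  have hn : 0 < ‖x‖ := norm_pos_iff.2 hx
  have h1 := hC (‖x‖⁻¹ • x) (by simp [norm_smul, hn.ne'])
  rw [h.2.1, abs_of_pos (inv_pos.2 hn)] at h1
  have h2 := le_trans (le_abs_self _) h1
  rw [inv_mul_le_iff₀ hn] at h2
  nlinarith [le_abs_self C]

lemma TestN.zero {n : ℕ} {A : Set (Rn n)} {φ : Rn n → ℝ} (h : IsNormN φ) :
    TestN A φ (fun _ => 0) := by
  refine ⟨contDiff_const, HasCompactSupport.zero, ?_, fun x => by rw [h.zero]; norm_num⟩
  have : tsupport (fun _ : Rn n => (0 : Rn n)) = ∅ := tsupport_eq_empty_iff.2 rfl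
  rw [this]; exact empty_subset _

lemma TestN.csmul {n : ℕ} {A B : Set (Rn n)} {φ χ : Rn n → ℝ} {η : Rn n → Rn n}
    (h : TestN A φ η) (hAB : A ⊆ B) (c : ℝ) (hc : ∀ x, φ x ≤ 1 → χ (c • x) ≤ 1) :
    TestN B χ (fun x => c • η x) := by
  refine ⟨h.1.const_smul c, h.2.1.smul_left (f := fun _ => c), ?_, fun x => hc _ (h.2.2.2 x)⟩
  exact (tsupport_smul_subset_right (fun _ => c) η).trans (h.2.2.1.trans hAB)

lemma TestN.diff {n : ℕ} {A : Set (Rn n)} {φ : Rn n → ℝ} {η : Rn n → Rn n}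
    (h : TestN A φ η) (x : Rn n) : DifferentiableAt ℝ η x := h.1.differentiable (by norm_num) x

lemma TestN.fsmul {n : ℕ} {A : Set (Rn n)} {φ : Rn n → ℝ} (hφ : IsNormN φ) {η : Rn n → Rn n}
    (h : TestN A φ η) {ψ : Rn n → ℝ} (hψ : ContDiff ℝ 1 ψ) (hψ1 : ∀ x, 0 ≤ ψ x ∧ ψ x ≤ 1) :
    TestN A φ (fun x => ψ x • η x) := by
  refine ⟨hψ.smul h.1, h.2.1.smul_left (f := ψ), ?_, fun x => ?_⟩
  · exact (tsupport_smul_subset_right ψ η).trans h.2.2.1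
  · rw [hφ.2.1, abs_of_nonneg (hψ1 x).1]
    exact mul_le_one₀ (hψ1 x).2 (hφ.nonneg _) (h.2.2.2 x)

lemma setInt_ind {n : ℕ} {A F : Set (Rn n)} (hA : IsOpen A) (hF : NullMeasurableSet F)
    {ζ : Rn n → Rn n} (hζ : tsupport ζ ⊆ A) :
    ∫ x in A, F.indicator (fun _ => (1:ℝ)) x * divN ζ x = ∫ x in F, divN ζ x := by
  rw [setInt_eq hA hζ (G := F.indicator (fun _ => (1:ℝ))) (fun _ _ => rfl), ← integral_indicator₀ hF]
  refine integral_congr_ae (Eventually.of_forall fun x => ?_)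
  by_cases hx : x ∈ F <;> simp [hx]

/-- main upper bound for competitor -/
lemma upper_bound {n : ℕ} {A F : Set (Rn n)} (hA : IsOpen A) {φ : Rn n → ℝ} (hφ : IsNormN φ)
    {u : Rn n → ℝ} (hu : IntegrableOn u A) {M : ℝ}
    (hM : ∀ θ, TestN A φ θ → ∫ x in A, u x * divN θ x ≤ M) {T : ℝ → ℝ} (hT : ContDiff ℝ 2 T)
    (hT' : ∀ s, 0 ≤ deriv T s ∧ deriv T s ≤ 1) {c : ℝ} (hTb : ∀ s, 0 ≤ T s ∧ T s ≤ c)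
    {c₀ : ℝ} (hc₀ : 0 < c₀) (hφ₀ : ∀ ξ, c₀ * ‖ξ‖ ≤ φ ξ)
    (hF : NullMeasurableSet F) {P : ℝ} (hP : ∀ θ, TestN A φ θ → ∫ x in F, divN θ x ≤ P)
    {ψ : Rn n → ℝ} (hψ : ContDiff ℝ 1 ψ) (hψs : HasCompactSupport ψ)
    (hψ1 : ∀ x, 0 ≤ ψ x ∧ ψ x ≤ 1)
    {η η₀ : Rn n → Rn n} (hη : TestN A φ η) (hη₀ : TestN A φ η₀)
    (hψη : ∀ x ∈ tsupport η₀, ψ x = 1) :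
    (∫ x in A, (u x + ψ x * (c * F.indicator (fun _ => (1:ℝ)) x - T (u x))) * divN η x)
      + (∫ x in A, T (u x) * divN η₀ x) ≤ M + c * P +
      1 / c₀ * ∫ x in A, |c * F.indicator (fun _ => (1:ℝ)) x - T (u x)| * ‖fderiv ℝ ψ x‖ := by
  set χ : Rn n → ℝ := F.indicator (fun _ => (1:ℝ)) with hχ
  have hc : 0 ≤ c := (hTb 0).1.trans (hTb 0).2
  have hTn : ∀ s, ‖T s‖ ≤ c := fun s => by
    rw [Real.norm_eq_abs, abs_of_nonneg (hTb s).1]; exact (hTb s).2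
  have hψ' : ContDiff ℝ 1 (fun x => 1 - ψ x) := contDiff_const.sub hψ
  have hψ'1 : ∀ x, 0 ≤ 1 - ψ x ∧ 1 - ψ x ≤ 1 := fun x =>
    ⟨by linarith [(hψ1 x).2], by linarith [(hψ1 x).1]⟩
  have t1 := hη.fsmul hφ hψ hψ1
  have t2 := hη.fsmul hφ hψ' hψ'1
  have t3 : TestN A φ (fun x => (1 - ψ x) • η x + η₀ x) := by
    refine ⟨t2.1.add hη₀.1, t2.2.1.add hη₀.2.1, ?_, fun x => ?_⟩
    · exact (tsupport_add _ _).trans (union_subset t2.2.2.1 hη₀.2.2.1)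
    · by_cases hx : x ∈ tsupport η₀
      · simp only [hψη x hx, sub_self, zero_smul, zero_add]; exact hη₀.2.2.2 x
      · simp only [image_eq_zero_of_notMem_tsupport hx, add_zero]; exact t2.2.2.2 x
  have hkey := key hA hφ.1 hu hM hT hT' hTn hη t3
  have hper := hP _ t1
  rw [← setInt_ind hA hF t1.2.2.1] at hper
  -- measurability
  have hTm : AEStronglyMeasurable (fun x => T (u x)) (volume.restrict A) :=
    hT.continuous.comp_aestronglyMeasurable hu.aestronglyMeasurable
  have hχm : AEStronglyMeasurable χ (volume.restrict A) :=
    (aestronglyMeasurable_const.indicator₀ hF).restrict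
  have hχb : ∀ x, 0 ≤ χ x ∧ χ x ≤ 1 := fun x => by
    by_cases hx : x ∈ F <;> simp [hχ, hx]
  have hχn : ∀ x, ‖χ x‖ ≤ 1 := fun x => by
    rw [Real.norm_eq_abs, abs_of_nonneg (hχb x).1]; exact (hχb x).2
  have hdb : ∀ x, ‖c * χ x - T (u x)‖ ≤ c := fun x => by
    rw [Real.norm_eq_abs, abs_le]
    have h1 := hχb x; have h2 := hTb (u x)
    constructor <;> nlinarith
  have iT : ∀ {f : Rn n → ℝ}, Integrable f → IntegrableOn (fun x => T (u x) * f x) A := fun hf =>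
    hf.integrableOn.bdd_mul (c := c) hTm (Eventually.of_forall fun x => hTn _)
  have iχ : ∀ {f : Rn n → ℝ}, Integrable f → IntegrableOn (fun x => χ x * f x) A := fun hf =>
    hf.integrableOn.bdd_mul (c := 1) hχm (Eventually.of_forall hχn)
  have id : ∀ {f : Rn n → ℝ}, Integrable f →
      IntegrableOn (fun x => (c * χ x - T (u x)) * f x) A := fun hf =>
    hf.integrableOn.bdd_mul (c := c) ((hχm.const_mul c).sub hTm) (Eventually.of_forall hdb)
  have iη := divN_integrable hη.1 hη.2.1
  have iη₀ := divN_integrable hη₀.1 hη₀.2.1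
  have i1 := divN_integrable t1.1 t1.2.1
  have i3 := divN_integrable t3.1 t3.2.1
  have iu : IntegrableOn (fun x => u x * divN η x) A := by
    obtain ⟨C, hC⟩ := bdd_of_cpt (divN_cont hη.1) (divN_supp hη.2.1)
    exact hu.mul_bdd (c := C) (divN_cont hη.1).aestronglyMeasurable (Eventually.of_forall hC)
  have cψ : Continuous (fderiv ℝ ψ) := hψ.continuous_fderiv (by norm_num)
  have cη := hη.1.continuous
  have iD : Integrable (fun x => fderiv ℝ ψ x (η x)) := by
    refine Continuous.integrable_of_hasCompactSupport (cψ.clm_apply cη) ?_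
    exact HasCompactSupport.intro hη.2.1 fun x hx => by
      rw [image_eq_zero_of_notMem_tsupport hx, map_zero]
  have iN : Integrable (fun x => ‖fderiv ℝ ψ x‖) :=
    cψ.norm.integrable_of_hasCompactSupport (hψs.fderiv ℝ).norm
  have ierr : IntegrableOn (fun x => |c * χ x - T (u x)| * ‖fderiv ℝ ψ x‖) A := by
    have := (id iN).norm
    refine this.congr (Eventually.of_forall fun x => ?_)
    simp
  have herr : -∫ x in A, (c * χ x - T (u x)) * fderiv ℝ ψ x (η x) ≤
      1 / c₀ * ∫ x in A, |c * χ x - T (u x)| * ‖fderiv ℝ ψ x‖ := by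
    rw [← integral_const_mul, ← integral_neg]
    refine integral_mono (id iD).neg (ierr.const_mul _) fun x => ?_
    have hηn : ‖η x‖ ≤ 1 / c₀ := by
      rw [le_div_iff₀ hc₀, mul_comm]; exact (hφ₀ _).trans (hη.2.2.2 x)
    have h1 : ‖fderiv ℝ ψ x (η x)‖ ≤ ‖fderiv ℝ ψ x‖ * (1 / c₀) :=
      ((fderiv ℝ ψ x).le_opNorm _).trans (mul_le_mul_of_nonneg_left hηn (norm_nonneg _))
    calc -((c * χ x - T (u x)) * fderiv ℝ ψ x (η x))
        ≤ |(c * χ x - T (u x)) * fderiv ℝ ψ x (η x)| := neg_le_abs _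
      _ = |c * χ x - T (u x)| * ‖fderiv ℝ ψ x (η x)‖ := abs_mul _ _
      _ ≤ |c * χ x - T (u x)| * (‖fderiv ℝ ψ x‖ * (1 / c₀)) :=
          mul_le_mul_of_nonneg_left h1 (abs_nonneg _)
      _ = 1 / c₀ * (|c * χ x - T (u x)| * ‖fderiv ℝ ψ x‖) := by ring
  have hdψ : ∀ x, DifferentiableAt ℝ ψ x := fun x => hψ.differentiable (by norm_num) x
  have hid : (∫ x in A, (u x + ψ x * (c * χ x - T (u x))) * divN η x)
      + (∫ x in A, T (u x) * divN η₀ x) =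
      ((∫ x in A, (u x - T (u x)) * divN η x) +
        ∫ x in A, T (u x) * divN (fun x => (1 - ψ x) • η x + η₀ x) x) +
      c * (∫ x in A, χ x * divN (fun x => ψ x • η x) x) +
      -∫ x in A, (c * χ x - T (u x)) * fderiv ℝ ψ x (η x) := by
    have ia : IntegrableOn (fun x => (u x - T (u x)) * divN η x) A := by
      refine (iu.sub (iT iη)).congr (Eventually.of_forall fun x => ?_)
      simp [sub_mul]
    have ib : IntegrableOn (fun x => (u x + ψ x * (c * χ x - T (u x))) * divN η x) A := by
      have : Integrable (fun x => ψ x * divN η x) :=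
        (hψ.continuous.mul (divN_cont hη.1)).integrable_of_hasCompactSupport
          (divN_supp hη.2.1).mul_left
      refine (iu.add (id this)).congr (Eventually.of_forall fun x => ?_)
      simp only [Pi.add_apply]; ring
    rw [← integral_const_mul, ← integral_neg, ← integral_add ib (iT iη₀), ← integral_add ia (iT i3)]
    have ic := (iχ i1).const_mul c
    have e1 := integral_add (ia.add (iT i3)) ic
    have e2 := integral_add ((ia.add (iT i3)).add ic) (id iD).neg
    simp only [Pi.add_apply, Pi.neg_apply] at e1 e2
    rw [← e1, ← e2]
    refine integral_congr_ae (Eventually.of_forall fun x => ?_)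
    simp only
    rw [divN_add' (t2.diff x) (hη₀.diff x), divN_smul' ((hdψ x).const_sub 1) (hη.diff x),
      divN_smul' (hdψ x) (hη.diff x), fderiv_const_sub]
    simp only [neg_apply]
    ring
  rw [hid]
  have := mul_le_mul_of_nonneg_left hper hc
  linarith

lemma BVlocSetN.bound {n : ℕ} {A Ω F : Set (Rn n)} {φ : Rn n → ℝ} (hφ : IsNormN φ)
    (hF : BVlocSetN Ω F) (hA : CpCtd A Ω) : BddAbove (perSetN φ F A) := by
  obtain ⟨c₀, hc₀, h₀⟩ := hφ.2.2
  obtain ⟨B, hB⟩ := hF A hA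
  refine ⟨1 / c₀ * B, ?_⟩
  rintro r ⟨η, hη, rfl⟩
  have ht : TestN A (fun x => ‖x‖) (fun x => c₀ • η x) := hη.csmul subset_rfl c₀ fun x hx => by
    rw [norm_smul, Real.norm_eq_abs, abs_of_pos hc₀]; exact (h₀ x).trans hx
  have := hB ⟨_, ht, rfl⟩
  simp_rw [fun x => divN_csmul c₀ x (hη.diff x)] at this
  rw [integral_const_mul] at this
  rw [div_mul_eq_mul_div, one_mul, le_div_iff₀ hc₀]
  linarith

lemma perSetN_le {n : ℕ} {A F : Set (Rn n)} {φ : Rn n → ℝ} (hφ : IsNormN φ) {P : ℝ}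
    (hP : P ∈ upperBounds (perSetN φ F A)) : ∀ θ, TestN A φ θ → ∫ x in F, divN θ x ≤ P := by
  intro θ hθ
  have ht : TestN A φ (fun x => (-1 : ℝ) • θ x) := hθ.csmul subset_rfl (-1) fun x hx => by
    rw [hφ.2.1]; simpa using hx
  have := hP ⟨_, ht, rfl⟩
  simp_rw [fun x => divN_csmul (-1) x (hθ.diff x)] at this
  rw [integral_const_mul] at this
  linarith

lemma comp_BV {n : ℕ} {Ω F : Set (Rn n)} {u : Rn n → ℝ} (hu : BVlocFun Ω u)
    {T : ℝ → ℝ} (hT : ContDiff ℝ 2 T)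
    (hT' : ∀ s, 0 ≤ deriv T s ∧ deriv T s ≤ 1) {c : ℝ} (hTb : ∀ s, 0 ≤ T s ∧ T s ≤ c)
    (hF : NullMeasurableSet F) (hFb : BVlocSetN Ω F)
    {ψ : Rn n → ℝ} (hψ : ContDiff ℝ 1 ψ) (hψs : HasCompactSupport ψ)
    (hψ1 : ∀ x, 0 ≤ ψ x ∧ ψ x ≤ 1) :
    BVlocFun Ω (fun x => u x + ψ x * (c * F.indicator (fun _ => (1:ℝ)) x - T (u x))) := by
  refine ⟨fun A hA => ?_, fun A hA => ?_⟩
  · have hui := hu.1 A hA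
    refine Integrable.add hui ?_
    have hTm : AEStronglyMeasurable (fun x => T (u x)) (volume.restrict A) :=
      hT.continuous.comp_aestronglyMeasurable hui.aestronglyMeasurable
    have hχm : AEStronglyMeasurable (F.indicator (fun _ => (1:ℝ))) (volume.restrict A) :=
      (aestronglyMeasurable_const.indicator₀ hF).restrict
    have hψi : IntegrableOn ψ A :=
      (hψ.continuous.integrable_of_hasCompactSupport hψs).integrableOn
    refine hψi.mul_bdd (c := c) ((hχm.const_mul c).sub hTm) (Eventually.of_forall fun x => ?_)
    rw [Real.norm_eq_abs, abs_le]
    have h2 := hTb (u x)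
    by_cases hx : x ∈ F <;> simp [hx] <;> constructor <;> linarith
  · obtain ⟨M, hM⟩ := hu.2 A hA
    obtain ⟨P, hP⟩ := hFb A hA
    refine ⟨M + c * P + 1 / 1 * ∫ x in A, |c * F.indicator (fun _ => (1:ℝ)) x - T (u x)|
      * ‖fderiv ℝ ψ x‖, ?_⟩
    rintro r ⟨η, hη, rfl⟩
    have := upper_bound hA.1 isNormN_norm (hu.1 A hA) (fun θ hθ => hM ⟨θ, hθ, rfl⟩) hT hT' hTb
      one_pos (fun ξ => by simp) hF (perSetN_le isNormN_norm hP) hψ hψs hψ1 hη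
      (TestN.zero isNormN_norm) (fun x hx => by
        have h0 : tsupport (fun _ : Rn n => (0 : Rn n)) = ∅ := tsupport_eq_empty_iff.2 rfl
        rw [h0] at hx; exact hx.elim)
    have h0 : ∀ x : Rn n, divN (fun _ : Rn n => (0 : Rn n)) x = 0 := fun x => by simp [divN]
    simp only [h0, mul_zero, integral_zero, add_zero] at this
    exact this

lemma cpct_vol {n : ℕ} {A Ω : Set (Rn n)} (hA : CpCtd A Ω) : volume A < ⊤ :=
  lt_of_le_of_lt (measure_mono subset_closure) hA.2.1.measure_lt_top

lemma Gset_bdd {n : ℕ} {Φ : Rn1 n → ℝ} {φ : Rn n → ℝ} (hφ : IsNormN φ) (hcyl : Cylindrical Φ φ)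
    {Ω A : Set (Rn n)} {u : Rn n → ℝ} (hu : BVlocFun Ω u) (hA : CpCtd A Ω) :
    BddAbove (Gset Φ A u) := by
  obtain ⟨c₀, hc₀, h₀⟩ := hφ.2.2
  obtain ⟨B, hB⟩ := hu.2 A hA
  refine ⟨1 / c₀ * B + ∫ x in A, (1:ℝ), ?_⟩
  rintro r ⟨η, h1, h2, h3, h4, rfl⟩
  have hη : TestN A φ (fun x => (η x).1) := by
    refine ⟨contDiff_fst.comp h1, h2.comp_left (g := Prod.fst) rfl, ?_, fun x => ?_⟩
    · exact (closure_mono (Function.support_comp_subset (g := Prod.fst) rfl η)).trans h3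
    · have := h4 x; rw [hcyl] at this; exact (le_max_left _ _).trans this
  have ht : TestN A (fun x => ‖x‖) (fun x => c₀ • (η x).1) := hη.csmul subset_rfl c₀ fun x hx => by
    rw [norm_smul, Real.norm_eq_abs, abs_of_pos hc₀]; exact (h₀ x).trans hx
  have hb := hB ⟨_, ht, rfl⟩
  simp_rw [fun x => divN_csmul c₀ x (hη.diff x)] at hb
  have hb' : c₀ * ∫ x in A, u x * divN (fun x => (η x).1) x ≤ B := by
    rw [← integral_const_mul]
    refine le_trans (le_of_eq ?_) hb
    congr 1; ext x; ring
  have iu : IntegrableOn (fun x => u x * divN (fun x => (η x).1) x) A := by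
    obtain ⟨C, hC⟩ := bdd_of_cpt (divN_cont hη.1) (divN_supp hη.2.1)
    exact (hu.1 A hA).mul_bdd (c := C) (divN_cont hη.1).aestronglyMeasurable
      (Eventually.of_forall hC)
  have i2 : Integrable (fun x => (η x).2) :=
    (continuous_snd.comp h1.continuous).integrable_of_hasCompactSupport
      (h2.comp_left (g := Prod.snd) rfl)
  rw [integral_add iu i2.integrableOn]
  refine add_le_add ?_ ?_
  · rw [div_mul_eq_mul_div, one_mul, le_div_iff₀ hc₀]
    linarith
  · refine integral_mono i2.integrableOn (integrableOn_const (cpct_vol hA).ne) fun x => ?_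
    have := h4 x; rw [hcyl] at this
    exact (le_abs_self _).trans ((le_max_right _ _).trans this)

lemma core {n : ℕ} {Φ : Rn1 n → ℝ} {φ : Rn n → ℝ} (hφ : IsNormN φ) (hcyl : Cylindrical Φ φ)
    {Ω A F : Set (Rn n)} {u : Rn n → ℝ} (hmin : MinG Φ Ω u) (hA : CpCtd A Ω)
    {T : ℝ → ℝ} (hT : ContDiff ℝ 2 T)
    (hT' : ∀ s, 0 ≤ deriv T s ∧ deriv T s ≤ 1) {c : ℝ} (hTb : ∀ s, 0 ≤ T s ∧ T s ≤ c)
    {c₀ : ℝ} (hc₀ : 0 < c₀) (hφ₀ : ∀ ξ, c₀ * ‖ξ‖ ≤ φ ξ)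
    (hF : NullMeasurableSet F) (hFb : BVlocSetN Ω F)
    {P : ℝ} (hP : ∀ θ, TestN A φ θ → ∫ x in F, divN θ x ≤ P)
    {ψ : Rn n → ℝ} (hψ : ContDiff ℝ 1 ψ) (hψs : HasCompactSupport ψ) (hψA : tsupport ψ ⊆ A)
    (hψ1 : ∀ x, 0 ≤ ψ x ∧ ψ x ≤ 1)
    {η₀ : Rn n → Rn n} (hη₀ : TestN A φ η₀) (hψη : ∀ x ∈ tsupport η₀, ψ x = 1) :
    (∫ x in A, T (u x) * divN η₀ x) ≤ c * P +
      1 / c₀ * ∫ x in A, |c * F.indicator (fun _ => (1:ℝ)) x - T (u x)| * ‖fderiv ℝ ψ x‖ := by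
  set v := fun x => u x + ψ x * (c * F.indicator (fun _ => (1:ℝ)) x - T (u x)) with hv
  have hvBV : BVlocFun Ω v := comp_BV hmin.1 hT hT' hTb hF hFb hψ hψs hψ1
  have hsub : tsupport (fun x => u x - v x) ⊆ tsupport ψ := by
    refine closure_mono fun x hx h => hx ?_
    simp [hv, h]
  have hmin' := hmin.2 A hA v hvBV
    ⟨hψs.of_isClosed_subset (isClosed_tsupport _) hsub, hsub.trans hψA⟩
  have hbd := Gset_bdd hφ hcyl hmin.1 hA
  have hle : Gfun Φ v A ≤ Gfun Φ u A - (∫ x in A, T (u x) * divN η₀ x) + c * P +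
      1 / c₀ * ∫ x in A, |c * F.indicator (fun _ => (1:ℝ)) x - T (u x)| * ‖fderiv ℝ ψ x‖ := by
    refine csSup_le ⟨_, fun _ => 0, contDiff_const, HasCompactSupport.zero, ?_, ?_, rfl⟩ ?_
    · have : tsupport (fun _ : Rn n => (0 : Rn1 n)) = ∅ := tsupport_eq_empty_iff.2 rfl
      rw [this]; exact empty_subset _
    · intro x; rw [hcyl]; simp [hφ.zero]
    rintro r ⟨η, h1, h2, h3, h4, rfl⟩
    have hη : TestN A φ (fun x => (η x).1) := by
      refine ⟨contDiff_fst.comp h1, h2.comp_left (g := Prod.fst) rfl, ?_, fun x => ?_⟩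
      · exact (closure_mono (Function.support_comp_subset (g := Prod.fst) rfl η)).trans h3
      · have := h4 x; rw [hcyl] at this; exact (le_max_left _ _).trans this
    have i2 : Integrable (fun x => (η x).2) :=
      (continuous_snd.comp h1.continuous).integrable_of_hasCompactSupport
        (h2.comp_left (g := Prod.snd) rfl)
    have ii : ∀ {w : Rn n → ℝ}, IntegrableOn w A → ∀ {θ}, TestN A φ θ →
        IntegrableOn (fun x => w x * divN θ x) A := by
      intro w hw θ hθ
      obtain ⟨C, hC⟩ := bdd_of_cpt (divN_cont hθ.1) (divN_supp hθ.2.1)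
      exact hw.mul_bdd (c := C) (divN_cont hθ.1).aestronglyMeasurable (Eventually.of_forall hC)
    have hM : ∀ θ, TestN A φ θ →
        ∫ x in A, u x * divN θ x ≤ Gfun Φ u A - ∫ x in A, (η x).2 := by
      intro θ hθ
      have hz : ∀ x, x ∉ tsupport θ ∪ tsupport η → (θ x, (η x).2) = (0 : Rn1 n) := fun x hx => by
        have e1 : θ x = 0 := image_eq_zero_of_notMem_tsupport fun h => hx (Or.inl h)
        have e2 : η x = 0 := image_eq_zero_of_notMem_tsupport fun h => hx (Or.inr h)
        simp [e1, e2]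
      have hKc : IsCompact (tsupport θ ∪ tsupport η) := IsCompact.union hθ.2.1 h2
      have hmem : (∫ x in A, (u x * divN (fun y => ((θ y, (η y).2) : Rn1 n).1) x
          + ((θ x, (η x).2) : Rn1 n).2)) ∈ Gset Φ A u := by
        refine ⟨fun x => (θ x, (η x).2), hθ.1.prodMk (contDiff_snd.comp h1),
          HasCompactSupport.intro hKc hz, ?_, fun x => ?_, rfl⟩
        · refine (closure_minimal (fun x hx => ?_) hKc.isClosed).trans
            (union_subset hθ.2.2.1 h3)
          by_contra h; exact hx (hz x h)
        · rw [hcyl]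
          have := h4 x; rw [hcyl] at this
          exact max_le (hθ.2.2.2 x) ((le_max_right _ _).trans this)
      have h := le_csSup hbd hmem
      simp only at h
      rw [integral_add (ii (hmin.1.1 A hA) hθ) i2.integrableOn] at h
      exact le_sub_iff_add_le.2 h
    have := upper_bound hA.1 hφ (hmin.1.1 A hA) hM hT hT' hTb hc₀ hφ₀ hF hP hψ hψs hψ1 hη hη₀ hψη
    rw [integral_add (ii (hvBV.1 A hA) hη) i2.integrableOn]
    simp only [hv]
    linarith
  linarith

open scoped Manifold ContDiff in
lemma cutoff {n : ℕ} {K A : Set (Rn n)} (hK : IsCompact K) (hA : IsOpen A) (hKA : K ⊆ A) :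
    ∃ ψ : Rn n → ℝ, ContDiff ℝ 1 ψ ∧ HasCompactSupport ψ ∧ tsupport ψ ⊆ A ∧
      (∀ x, 0 ≤ ψ x ∧ ψ x ≤ 1) ∧ ∀ x ∈ K, ψ x = 1 := by
  obtain ⟨V, hV, hKV, hVA, hVc⟩ := exists_open_between_and_isCompact_closure hK hA hKA
  obtain ⟨g, g1, g2, g3, g4⟩ := exists_contMDiff_support_eq_eq_one_iff (n := 1) 𝓘(ℝ, Rn n) hV
    hK.isClosed hKV
  refine ⟨g, g1.contDiff, ?_, ?_, fun x => g2 (mem_range_self x), fun x hx => (g4 x).1 hx⟩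
  · rw [HasCompactSupport, tsupport, g3]; exact hVc
  · rw [tsupport, g3]; exact hVA

lemma limit_ineq {n : ℕ} {Φ : Rn1 n → ℝ} {φ : Rn n → ℝ} (hφ : IsNormN φ) (hcyl : Cylindrical Φ φ)
    {Ω A F E : Set (Rn n)} {u : Rn n → ℝ} (hmin : MinG Φ Ω u) (hA : CpCtd A Ω)
    {S : ℕ → ℝ → ℝ} (hS : ∀ k, ContDiff ℝ 2 (S k)) (hS1 : ∀ k s, 0 ≤ S k s ∧ S k s ≤ 1)
    (hSd : ∀ k, ∃ L > 0, ∀ s, 0 ≤ deriv (S k) s ∧ deriv (S k) s ≤ L)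
    (hlim : ∀ x ∈ Ω, Tendsto (fun k => S k (u x)) atTop (𝓝 (E.indicator (fun _ => (1:ℝ)) x)))
    {c₀ : ℝ} (hc₀ : 0 < c₀) (hφ₀ : ∀ ξ, c₀ * ‖ξ‖ ≤ φ ξ)
    (hF : NullMeasurableSet F) (hFb : BVlocSetN Ω F)
    {P : ℝ} (hP : ∀ θ, TestN A φ θ → ∫ x in F, divN θ x ≤ P)
    {ψ : Rn n → ℝ} (hψ : ContDiff ℝ 1 ψ) (hψs : HasCompactSupport ψ) (hψA : tsupport ψ ⊆ A)
    (hψ1 : ∀ x, 0 ≤ ψ x ∧ ψ x ≤ 1)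
    {η₀ : Rn n → Rn n} (hη₀ : TestN A φ η₀) (hψη : ∀ x ∈ tsupport η₀, ψ x = 1) :
    (∫ x in A, E.indicator (fun _ => (1:ℝ)) x * divN η₀ x) ≤ P +
      1 / c₀ * ∫ x in A, |F.indicator (fun _ => (1:ℝ)) x - E.indicator (fun _ => (1:ℝ)) x|
        * ‖fderiv ℝ ψ x‖ := by
  have hAm : MeasurableSet A := hA.1.measurableSet
  have hAΩ : A ⊆ Ω := subset_closure.trans hA.2.2
  have hk : ∀ k, (∫ x in A, S k (u x) * divN η₀ x) ≤ P +
      1 / c₀ * ∫ x in A, |F.indicator (fun _ => (1:ℝ)) x - S k (u x)| * ‖fderiv ℝ ψ x‖ := by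
    intro k
    obtain ⟨L, hL, hSL⟩ := hSd k
    have hdiff : Differentiable ℝ (S k) := (hS k).differentiable (by norm_num)
    have h := core (T := fun s => 1 / L * S k s) (c := 1 / L) hφ hcyl hmin hA
      (contDiff_const.mul (hS k)) (fun s => by
        rw [deriv_const_mul _ (hdiff s)]
        refine ⟨mul_nonneg (by positivity) (hSL s).1, ?_⟩
        rw [one_div, inv_mul_le_iff₀ hL]; linarith [(hSL s).2])
      (fun s => ⟨mul_nonneg (by positivity) (hS1 k s).1,
        mul_le_of_le_one_right (by positivity) (hS1 k s).2⟩) hc₀ hφ₀ hF hFb hP hψ hψs hψA hψ1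
      hη₀ hψη
    have e1 : (∫ x in A, 1 / L * S k (u x) * divN η₀ x) =
        1 / L * ∫ x in A, S k (u x) * divN η₀ x := by
      rw [← integral_const_mul]; simp only [mul_assoc]
    have e2 : (∫ x in A, |1 / L * F.indicator (fun _ => (1:ℝ)) x - 1 / L * S k (u x)|
        * ‖fderiv ℝ ψ x‖) =
        1 / L * ∫ x in A, |F.indicator (fun _ => (1:ℝ)) x - S k (u x)| * ‖fderiv ℝ ψ x‖ := by
      rw [← integral_const_mul]
      congr 1; ext x
      rw [← mul_sub, abs_mul, abs_of_pos (by positivity : 0 < 1 / L), mul_assoc]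
    rw [e1, e2] at h
    have hL' : 0 < 1 / L := by positivity
    refine le_of_mul_le_mul_left (h.trans_eq ?_) hL'
    ring
  have hu : AEStronglyMeasurable u (volume.restrict A) := (hmin.1.1 A hA).1
  have hSm : ∀ k, AEStronglyMeasurable (fun x => S k (u x)) (volume.restrict A) := fun k =>
    (hS k).continuous.comp_aestronglyMeasurable hu
  have hae : ∀ᵐ x ∂(volume.restrict A),
      Tendsto (fun k => S k (u x)) atTop (𝓝 (E.indicator (fun _ => (1:ℝ)) x)) := by
    filter_upwards [ae_restrict_mem hAm] with x hx using hlim x (hAΩ hx)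
  have hdint : Integrable (fun x => divN η₀ x) := divN_integrable hη₀.1 hη₀.2.1
  have hψc : Continuous (fun x => ‖fderiv ℝ ψ x‖) :=
    (hψ.continuous_fderiv (by norm_num)).norm
  have hψint : Integrable (fun x => ‖fderiv ℝ ψ x‖) :=
    hψc.integrable_of_hasCompactSupport (hψs.fderiv ℝ).norm
  have l1 : Tendsto (fun k => ∫ x in A, S k (u x) * divN η₀ x) atTop
      (𝓝 (∫ x in A, E.indicator (fun _ => (1:ℝ)) x * divN η₀ x)) := by
    refine tendsto_integral_of_dominated_convergence (fun x => ‖divN η₀ x‖)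
      (fun k => (hSm k).mul hdint.restrict.1) hdint.restrict.norm (fun k => ?_) ?_
    · refine Eventually.of_forall fun x => ?_
      rw [norm_mul, Real.norm_of_nonneg (hS1 k _).1]
      exact mul_le_of_le_one_left (norm_nonneg _) (hS1 k _).2
    · filter_upwards [hae] with x hx using hx.mul_const _
  have hFm : AEStronglyMeasurable (F.indicator (fun _ => (1:ℝ))) (volume.restrict A) :=
    (aestronglyMeasurable_const.indicator₀ hF).restrict
  have l2 : Tendsto (fun k => ∫ x in A, |F.indicator (fun _ => (1:ℝ)) x - S k (u x)|
        * ‖fderiv ℝ ψ x‖) atTop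
      (𝓝 (∫ x in A, |F.indicator (fun _ => (1:ℝ)) x - E.indicator (fun _ => (1:ℝ)) x|
        * ‖fderiv ℝ ψ x‖)) := by
    refine tendsto_integral_of_dominated_convergence (fun x => ‖fderiv ℝ ψ x‖)
      (fun k => ((hFm.sub (hSm k)).norm).mul hψint.restrict.1) hψint.restrict (fun k => ?_) ?_
    · refine Eventually.of_forall fun x => ?_
      rw [norm_mul, norm_norm, norm_abs_eq_norm]
      refine mul_le_of_le_one_left (norm_nonneg _) ?_
      have h1 := hS1 k (u x)
      rw [Real.norm_eq_abs, abs_le]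
      by_cases hx : x ∈ F <;> simp [hx] <;> constructor <;> linarith [h1.1, h1.2]
    · filter_upwards [hae] with x hx using ((tendsto_const_nhds.sub hx).abs).mul_const _
  exact le_of_tendsto_of_tendsto' l1 (tendsto_const_nhds.add (l2.const_mul _)) hk

lemma fix_meas {n : ℕ} {E F K : Set (Rn n)} (hE : NullMeasurableSet E) (hK : IsCompact K)
    (hEF : symmDiff E F ⊆ K) :
    ∃ F' : Set (Rn n), NullMeasurableSet F' ∧ volume.restrict F' = volume.restrict F ∧
      ∀ x, x ∉ K → (x ∈ E ↔ x ∈ F') := by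
  have hKm : MeasurableSet K := hK.measurableSet
  have hd : F \ K = E \ K := by
    ext x
    have := @hEF x
    rw [Set.mem_symmDiff] at this
    simp only [Set.mem_sdiff]
    tauto
  refine ⟨(toMeasurable volume (F ∩ K) ∩ K) ∪ (E \ K), ?_, ?_, ?_⟩
  · exact ((measurableSet_toMeasurable _ _).inter hKm).nullMeasurableSet.union
      (hE.diff hKm.nullMeasurableSet)
  · have hfin : volume (F ∩ K) ≠ ⊤ :=
      ((measure_mono inter_subset_right).trans_lt hK.measure_lt_top).ne
    rw [← Measure.restrict_inter_add_sdiff F hKm,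
      ← Measure.restrict_inter_add_sdiff (toMeasurable volume (F ∩ K) ∩ K ∪ E \ K) hKm]
    have a1 : (toMeasurable volume (F ∩ K) ∩ K ∪ E \ K) ∩ K = toMeasurable volume (F ∩ K) ∩ K := by
      ext x; simp only [mem_inter_iff, mem_union, Set.mem_sdiff]; tauto
    have a2 : (toMeasurable volume (F ∩ K) ∩ K ∪ E \ K) \ K = E \ K := by
      ext x; simp only [mem_inter_iff, mem_union, Set.mem_sdiff]; tauto
    rw [a1, a2, hd]
    congr 1
    rw [inter_comm, ← Measure.restrict_restrict hKm, Measure.restrict_toMeasurable hfin,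
      Measure.restrict_restrict hKm]
    congr 1
    ext x; simp only [mem_inter_iff]; tauto
  · intro x hx
    simp only [mem_inter_iff, mem_union, Set.mem_sdiff]; tauto

lemma minPer_of_lim {n : ℕ} {Φ : Rn1 n → ℝ} {φ : Rn n → ℝ} (hφ : IsNormN φ)
    (hcyl : Cylindrical Φ φ)
    {Ω E : Set (Rn n)} (hΩ : IsOpen Ω) {u : Rn n → ℝ} (hmin : MinG Φ Ω u)
    (hE : NullMeasurableSet E)
    {S : ℕ → ℝ → ℝ} (hS : ∀ k, ContDiff ℝ 2 (S k)) (hS1 : ∀ k s, 0 ≤ S k s ∧ S k s ≤ 1)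
    (hSd : ∀ k, ∃ L > 0, ∀ s, 0 ≤ deriv (S k) s ∧ deriv (S k) s ≤ L)
    (hlim : ∀ x ∈ Ω, Tendsto (fun k => S k (u x)) atTop (𝓝 (E.indicator (fun _ => (1:ℝ)) x))) :
    MinPerN φ Ω E := by
  obtain ⟨c₀, hc₀, hφ₀⟩ := hφ.2.2
  constructor
  · intro A' hA'
    obtain ⟨A, hAo, hA'A, hAΩ, hAc⟩ :=
      exists_open_between_and_isCompact_closure hA'.2.1 hΩ hA'.2.2
    have hA : CpCtd A Ω := ⟨hAo, hAc, hAΩ⟩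
    obtain ⟨ψ, hψ, hψs, hψA, hψ1, hψK⟩ := cutoff hA'.2.1 hAo hA'A
    obtain ⟨C, hC, hCφ⟩ := hφ.upper
    have hb : BVlocSetN Ω (∅ : Set (Rn n)) := by
      intro B hB
      refine ⟨0, ?_⟩
      rintro r ⟨η, -, rfl⟩
      simp
    refine ⟨C * (0 + 1 / c₀ * ∫ x in A, |(∅ : Set (Rn n)).indicator (fun _ => (1:ℝ)) x
      - E.indicator (fun _ => (1:ℝ)) x| * ‖fderiv ℝ ψ x‖), ?_⟩
    rintro r ⟨η, hη, rfl⟩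
    have hη₀ : TestN A φ (fun x => (-(1 / C)) • η x) := by
      refine hη.csmul (subset_closure.trans hA'A) _ fun x hx => ?_
      have hx' : ‖x‖ ≤ 1 := hx
      rw [hφ.2.1, abs_neg, abs_of_pos (by positivity), one_div, inv_mul_le_iff₀ hC]
      exact (hCφ x).trans (mul_le_mul_of_nonneg_left hx' hC.le)
    have hts : tsupport (fun x => (-(1 / C)) • η x) ⊆ tsupport η :=
      tsupport_smul_subset_right (fun _ => _) η
    have h := limit_ineq hφ hcyl hmin hA hS hS1 hSd hlim hc₀ hφ₀ nullMeasurableSet_empty hb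
      (P := 0) (fun θ _ => by simp) hψ hψs hψA hψ1 hη₀
      (fun x hx => hψK x (subset_closure (hη.2.2.1 (hts hx))))
    rw [setInt_ind hAo hE hη₀.2.2.1] at h
    have e : ∫ x in E, divN (fun x => (-(1 / C)) • η x) x = -(1 / C) * ∫ x in E, divN η x := by
      rw [← integral_const_mul]
      congr 1; ext x
      exact divN_csmul _ _ ((hη.1.differentiable (by norm_num)) x)
    rw [e] at h
    have := mul_le_mul_of_nonneg_left h hC.le
    refine le_trans (le_of_eq ?_) this
    field_simp
  · intro A hA F hF hKc hKA
    set K := closure (symmDiff E F) with hKdef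
    obtain ⟨F', hF'm, hF'r, hF'E⟩ := fix_meas hE hKc (subset_closure : symmDiff E F ⊆ K)
    have hset : ∀ (χ : Rn n → ℝ) B, perSetN χ F' B = perSetN χ F B := by
      intro χ B
      unfold perSetN
      rw [hF'r]
    have hF'b : BVlocSetN Ω F' := by
      intro B hB
      rw [hset]
      exact hF B hB
    have hP : ∀ θ, TestN A φ θ → ∫ x in F', divN θ x ≤ PerN φ F A := by
      have hbd := hF'b.bound hφ hA
      refine perSetN_le hφ ?_
      intro r hr
      rw [PerN, ← hset]
      exact le_csSup hbd hr
    refine csSup_le ⟨_, _, TestN.zero hφ, rfl⟩ ?_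
    rintro r ⟨η, hη, rfl⟩
    have hη₀ : TestN A φ (fun x => (-1:ℝ) • η x) := by
      refine hη.csmul subset_rfl _ fun x hx => ?_
      rw [hφ.2.1]; simpa using hx
    have hts : tsupport (fun x => (-1:ℝ) • η x) ⊆ tsupport η :=
      tsupport_smul_subset_right (fun _ => _) η
    obtain ⟨ψ, hψ, hψs, hψA, hψ1, hψK⟩ := cutoff (hKc.union hη.2.1) hA.1
      (union_subset hKA hη.2.2.1)
    have h := limit_ineq hφ hcyl hmin hA hS hS1 hSd hlim hc₀ hφ₀ hF'm hF'b hP hψ hψs hψA hψ1 hη₀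
      (fun x hx => hψK x (Or.inr (hts hx)))
    have hz : ∀ x, |F'.indicator (fun _ => (1:ℝ)) x - E.indicator (fun _ => (1:ℝ)) x|
        * ‖fderiv ℝ ψ x‖ = 0 := by
      intro x
      by_cases hx : x ∈ K
      · have : IsLocalMax ψ x := Eventually.of_forall fun y => by
          rw [hψK x (Or.inl hx)]; exact (hψ1 y).2
        rw [this.fderiv_eq_zero]; simp
      · have := hF'E x hx
        by_cases hxE : x ∈ E
        · simp [hxE, this.1 hxE]
        · have h2 : x ∉ F' := fun h => hxE (this.2 h)
          simp [hxE, h2]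
    simp only [hz, integral_zero, mul_zero, add_zero] at h
    rw [setInt_ind hA.1 hE hη₀.2.2.1] at h
    have e : ∫ x in E, divN (fun x => (-1:ℝ) • η x) x = -1 * ∫ x in E, divN η x := by
      rw [← integral_const_mul]
      congr 1; ext x
      exact divN_csmul _ _ ((hη.1.differentiable (by norm_num)) x)
    rw [e] at h
    linarith

lemma smoothTr_deriv : ∃ L > 0, ∀ s, 0 ≤ deriv Real.smoothTransition s ∧
    deriv Real.smoothTransition s ≤ L := by
  have hc : Continuous (deriv Real.smoothTransition) :=
    (Real.smoothTransition.contDiff (n := 1)).continuous_deriv le_rfl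
  obtain ⟨M, hM⟩ := (isCompact_Icc (a := (0:ℝ)) (b := 1)).exists_bound_of_continuousOn
    hc.continuousOn
  refine ⟨max M 1, by positivity, fun s => ⟨Real.smoothTransition.monotone.deriv_nonneg, ?_⟩⟩
  by_cases hs : s ∈ Icc (0:ℝ) 1
  · exact (le_abs_self _).trans ((hM s hs).trans (le_max_left _ _))
  · have : deriv Real.smoothTransition s = 0 := by
      rw [mem_Icc, not_and_or, not_le, not_le] at hs
      rcases hs with hs | hs
      · have : Real.smoothTransition =ᶠ[𝓝 s] fun _ => 0 := by
          filter_upwards [Iio_mem_nhds hs] with y hy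
          exact Real.smoothTransition.zero_of_nonpos (le_of_lt hy)
        rw [this.deriv_eq]; simp
      · have : Real.smoothTransition =ᶠ[𝓝 s] fun _ => 1 := by
          filter_upwards [Ioi_mem_nhds hs] with y hy
          exact Real.smoothTransition.one_of_one_le (le_of_lt hy)
        rw [this.deriv_eq]; simp
    rw [this]; positivity

lemma minPer_level {n : ℕ} {Φ : Rn1 n → ℝ} {φ : Rn n → ℝ} (hφ : IsNormN φ)
    (hcyl : Cylindrical Φ φ)
    {Ω E : Set (Rn n)} (hΩ : IsOpen Ω) {u : Rn n → ℝ} (hmin : MinG Φ Ω u)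
    (hE : NullMeasurableSet E) (l b : ℝ)
    (hlim : ∀ x ∈ Ω, ∀ᶠ k : ℕ in atTop, Real.smoothTransition (k * (u x - l) + b) =
      E.indicator (fun _ => (1:ℝ)) x) :
    MinPerN φ Ω E := by
  refine minPer_of_lim hφ hcyl hΩ hmin hE
    (S := fun k s => Real.smoothTransition (k * (s - l) + b)) (fun k => ?_)
    (fun k s => ⟨Real.smoothTransition.nonneg _, Real.smoothTransition.le_one _⟩)
    (fun k => ?_) (fun x hx => tendsto_const_nhds.congr' ?_)
  · exact Real.smoothTransition.contDiff.comp
      ((contDiff_const.mul (contDiff_id.sub contDiff_const)).add contDiff_const)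
  · obtain ⟨L, hL, h⟩ := smoothTr_deriv
    have hd : ∀ s, deriv (fun s => Real.smoothTransition (k * (s - l) + b)) s =
        deriv Real.smoothTransition (k * (s - l) + b) * k := by
      intro s
      have h1 : HasDerivAt (fun s : ℝ => (k:ℝ) * (s - l) + b) k s := by
        simpa using (((hasDerivAt_id s).sub_const l).const_mul (k:ℝ)).add_const b
      have h2 := ((Real.smoothTransition.contDiff (n := 1)).differentiable (by norm_num)
        (k * (s - l) + b)).hasDerivAt
      exact (h2.comp s h1).deriv
    refine ⟨L * (k + 1), by positivity, fun s => ?_⟩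
    rw [hd]
    have hk : (0:ℝ) ≤ k := Nat.cast_nonneg k
    have := h (k * (s - l) + b)
    refine ⟨mul_nonneg this.1 hk, ?_⟩
    exact mul_le_mul this.2 (by linarith) hk hL.le
  · filter_upwards [hlim x hx] with k hk using hk.symm

lemma nullMeas_level {n : ℕ} {Ω : Set (Rn n)} (hΩ : IsOpen Ω) {u : Rn n → ℝ}
    (hu : BVlocFun Ω u) {s : Set ℝ} (hs : MeasurableSet s) :
    NullMeasurableSet {x | x ∈ Ω ∧ u x ∈ s} := by
  have hl : LocallyIntegrableOn u Ω := by
    intro x hx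
    obtain ⟨A, hAo, hxA, hAΩ, hAc⟩ :=
      exists_open_between_and_isCompact_closure (isCompact_singleton (x := x)) hΩ
        (singleton_subset_iff.2 hx)
    exact ⟨A, mem_nhdsWithin_of_mem_nhds (hAo.mem_nhds (hxA rfl)), hu.1 A ⟨hAo, hAc, hAΩ⟩⟩
  have hm : AEMeasurable u (volume.restrict Ω) := hl.aestronglyMeasurable.aemeasurable
  have := hm.nullMeasurableSet_preimage hs
  have h2 := (nullMeasurableSet_restrict hΩ.measurableSet.nullMeasurableSet).1 this
  convert h2 using 1
  ext x; simp [and_comm]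

theorem superlevel_sets_minimize_perimeter {n : ℕ} (Φ : Rn1 n → ℝ) (φ : Rn n → ℝ)
    (hΦ : IsNorm1 Φ) (hφ : IsNormN φ) (hcyl : Cylindrical Φ φ)
    (Ω : Set (Rn n)) (hΩ : IsOpen Ω) (u : Rn n → ℝ) (hmin : MinG Φ Ω u) (l : ℝ) :
    MinPerN φ Ω {x ∈ Ω | l < u x} ∧ MinPerN φ Ω {x ∈ Ω | l ≤ u x} := by
  have hbig : ∀ d : ℝ, 0 < d → ∀ᶠ k : ℕ in atTop, 1 ≤ (k:ℝ) * d := by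
    intro d hd
    exact (tendsto_natCast_atTop_atTop.atTop_mul_const hd).eventually_ge_atTop 1
  constructor
  · refine minPer_level hφ hcyl hΩ hmin (nullMeas_level hΩ hmin.1 (s := Ioi l) measurableSet_Ioi)
      l 0 fun x hx => ?_
    by_cases h : l < u x
    · filter_upwards [hbig (u x - l) (by linarith)] with k hk
      rw [Real.smoothTransition.one_of_one_le (by linarith), indicator_of_mem]
      exact ⟨hx, h⟩
    · refine Eventually.of_forall fun k => ?_
      have : (k:ℝ) * (u x - l) ≤ 0 := mul_nonpos_of_nonneg_of_nonpos (Nat.cast_nonneg k)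
        (by linarith [not_lt.1 h])
      rw [Real.smoothTransition.zero_of_nonpos (by linarith), indicator_of_notMem]
      exact fun h' => h h'.2
  · refine minPer_level hφ hcyl hΩ hmin (nullMeas_level hΩ hmin.1 (s := Ici l) measurableSet_Ici)
      l 1 fun x hx => ?_
    by_cases h : l ≤ u x
    · refine Eventually.of_forall fun k => ?_
      have : 0 ≤ (k:ℝ) * (u x - l) := mul_nonneg (Nat.cast_nonneg k) (by linarith)
      rw [Real.smoothTransition.one_of_one_le (by linarith), indicator_of_mem]
      exact ⟨hx, h⟩
    · filter_upwards [hbig (l - u x) (by linarith [not_le.1 h])] with k hk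
      rw [Real.smoothTransition.zero_of_nonpos (by linarith), indicator_of_notMem]
      exact fun h' => h h'.2
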